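/- For every z in the upper half-plane ℍ: Φ12′(x1(z),…,x6(z)) = Δ(z). -/

import Mathlib

open Complex Finset

noncomputable section

/-- `ζ = exp(2πi/13)`. -/
def zeta13 : ℂ := Complex.exp (2 * Real.pi * Complex.I / 13)

local notation "ζ" => zeta13

/-- The diagonal matrix `T = diag(ζ^7, ζ^11, ζ^8, ζ^6, ζ^2, ζ^5)`. -/
def Tmat : Matrix (Fin 6) (Fin 6) ℂ :=
  Matrix.diagonal ![ζ ^ 7, ζ ^ 11, ζ ^ 8, ζ ^ 6, ζ ^ 2, ζ ^ 5]

/-- The matrix `S = -(1/√13)·M`. -/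
def Smat : Matrix (Fin 6) (Fin 6) ℂ :=
  (-(1 / (Real.sqrt 13 : ℂ))) • Matrix.of
    ![![ζ^12 - ζ, ζ^10 - ζ^3, ζ^4 - ζ^9, ζ^5 - ζ^8, ζ^2 - ζ^11, ζ^6 - ζ^7],
      ![ζ^10 - ζ^3, ζ^4 - ζ^9, ζ^12 - ζ, ζ^2 - ζ^11, ζ^6 - ζ^7, ζ^5 - ζ^8],
      ![ζ^4 - ζ^9, ζ^12 - ζ, ζ^10 - ζ^3, ζ^6 - ζ^7, ζ^5 - ζ^8, ζ^2 - ζ^11],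
      ![ζ^5 - ζ^8, ζ^2 - ζ^11, ζ^6 - ζ^7, ζ - ζ^12, ζ^3 - ζ^10, ζ^9 - ζ^4],
      ![ζ^2 - ζ^11, ζ^6 - ζ^7, ζ^5 - ζ^8, ζ^3 - ζ^10, ζ^9 - ζ^4, ζ - ζ^12],
      ![ζ^6 - ζ^7, ζ^5 - ζ^8, ζ^2 - ζ^11, ζ^9 - ζ^4, ζ - ζ^12, ζ^3 - ζ^10]]

/-- The matrix `H`, mapping `(z1,…,z6)` to `(z6, z4, z5, −z3, −z1, −z2)`. -/
def Hmat : Matrix (Fin 6) (Fin 6) ℂ :=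
  Matrix.of
    ![![0,0,0,0,0,1], ![0,0,0,1,0,0], ![0,0,0,0,1,0],
      ![0,0,-1,0,0,0], ![-1,0,0,0,0,0], ![0,-1,0,0,0,0]]

/-- The senary quadratic forms `A_0, …, A_6` (here `v 0 = z1, …, v 5 = z6`). -/
def A : ℕ → (Fin 6 → ℂ) → ℂ
  | 0, v => v 0 * v 3 + v 1 * v 4 + v 2 * v 5
  | 1, v => v 0 ^ 2 - 2 * v 2 * v 3
  | 2, v => -v 4 ^ 2 - 2 * v 1 * v 3
  | 3, v => v 1 ^ 2 - 2 * v 0 * v 4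
  | 4, v => v 2 ^ 2 - 2 * v 1 * v 5
  | 5, v => -v 3 ^ 2 - 2 * v 0 * v 5
  | 6, v => -v 5 ^ 2 - 2 * v 2 * v 4
  | _, _ => 0

/-- `w_ν = (A0 + ζ^ν A1 + ζ^{4ν} A2 + ζ^{9ν} A3 + ζ^{3ν} A4 + ζ^{12ν} A5 + ζ^{10ν} A6)^2`. -/
def w (ν : ℕ) (v : Fin 6 → ℂ) : ℂ :=
  (A 0 v + ζ ^ ν * A 1 v + ζ ^ (4 * ν) * A 2 v + ζ ^ (9 * ν) * A 3 v +
    ζ ^ (3 * ν) * A 4 v + ζ ^ (12 * ν) * A 5 v + ζ ^ (10 * ν) * A 6 v) ^ 2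

/-- `w_∞ = 13·A0^2`. -/
def winf (v : Fin 6 → ℂ) : ℂ := 13 * A 0 v ^ 2

/-- The senary cubic forms `D_0, …, D_12` (here `v 0 = z1, …, v 5 = z6`). -/
def D : ℕ → (Fin 6 → ℂ) → ℂ
  | 0, v => v 0 * v 1 * v 2
  | 1, v => 2 * v 1 * v 2 ^ 2 + v 1 ^ 2 * v 5 - v 3 ^ 2 * v 4 + v 0 * v 4 * v 5
  | 2, v => -v 5 ^ 3 + v 1 ^ 2 * v 3 - 2 * v 1 * v 4 ^ 2 + v 0 * v 3 * v 4 + 3 * v 2 * v 4 * v 5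
  | 3, v => 2 * v 0 * v 1 ^ 2 + v 0 ^ 2 * v 4 - v 3 * v 5 ^ 2 + v 2 * v 3 * v 4
  | 4, v => -v 1 ^ 2 * v 2 + v 0 * v 5 ^ 2 - 2 * v 3 ^ 2 * v 5 - v 0 * v 2 * v 4
  | 5, v => -v 3 ^ 3 + v 2 ^ 2 * v 4 - 2 * v 2 * v 5 ^ 2 + v 1 * v 4 * v 5 + 3 * v 0 * v 3 * v 5
  | 6, v => -v 4 ^ 3 + v 0 ^ 2 * v 5 - 2 * v 0 * v 3 ^ 2 + v 2 * v 3 * v 5 + 3 * v 1 * v 3 * v 4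
  | 7, v => -v 1 ^ 3 + v 2 * v 3 ^ 2 - v 0 * v 2 * v 5 - 3 * v 0 * v 1 * v 4 + 2 * v 0 ^ 2 * v 3
  | 8, v => -v 0 ^ 3 + v 1 * v 5 ^ 2 - v 1 * v 2 * v 4 - 3 * v 0 * v 2 * v 3 + 2 * v 2 ^ 2 * v 5
  | 9, v => 2 * v 0 ^ 2 * v 2 + v 2 ^ 2 * v 3 - v 4 ^ 2 * v 5 + v 1 * v 3 * v 5
  | 10, v => -v 0 * v 2 ^ 2 + v 1 * v 3 ^ 2 - 2 * v 3 * v 4 ^ 2 - v 0 * v 1 * v 5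
  | 11, v => -v 2 ^ 3 + v 0 * v 4 ^ 2 - v 0 * v 1 * v 3 - 3 * v 1 * v 2 * v 5 + 2 * v 1 ^ 2 * v 4
  | 12, v => -v 0 ^ 2 * v 1 + v 2 * v 4 ^ 2 - 2 * v 4 * v 5 ^ 2 - v 1 * v 2 * v 3
  | _, _ => 0

/-- The senary cubic form `D_∞ = z4 z5 z6`. -/
def Dinf (v : Fin 6 → ℂ) : ℂ := v 3 * v 4 * v 5

/-- The senary sextic forms `G_0, …, G_12`. -/
def Gs : ℕ → (Fin 6 → ℂ) → ℂ
  | 0, v => D 0 v ^ 2 + Dinf v ^ 2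
  | 1, v => -D 7 v ^ 2 + 2 * D 0 v * D 1 v + 10 * Dinf v * D 1 v + 2 * D 2 v * D 12 v
      - 2 * D 3 v * D 11 v - 4 * D 4 v * D 10 v - 2 * D 9 v * D 5 v
  | 2, v => -2 * D 1 v ^ 2 - 4 * D 0 v * D 2 v + 6 * Dinf v * D 2 v - 2 * D 4 v * D 11 v
      + 2 * D 5 v * D 10 v - 2 * D 6 v * D 9 v - 2 * D 7 v * D 8 v
  | 3, v => -D 8 v ^ 2 + 2 * D 0 v * D 3 v + 10 * Dinf v * D 3 v + 2 * D 6 v * D 10 v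
      - 2 * D 9 v * D 7 v - 4 * D 12 v * D 4 v - 2 * D 1 v * D 2 v
  | 4, v => -D 2 v ^ 2 + 10 * D 0 v * D 4 v - 2 * Dinf v * D 4 v + 2 * D 5 v * D 12 v
      - 2 * D 9 v * D 8 v - 4 * D 1 v * D 3 v - 2 * D 10 v * D 7 v
  | 5, v => -2 * D 9 v ^ 2 - 4 * D 0 v * D 5 v + 6 * Dinf v * D 5 v - 2 * D 10 v * D 8 v
      + 2 * D 6 v * D 12 v - 2 * D 2 v * D 3 v - 2 * D 11 v * D 7 v
  | 6, v => -2 * D 3 v ^ 2 - 4 * D 0 v * D 6 v + 6 * Dinf v * D 6 v - 2 * D 12 v * D 7 v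
      + 2 * D 2 v * D 4 v - 2 * D 5 v * D 1 v - 2 * D 8 v * D 11 v
  | 7, v => -2 * D 10 v ^ 2 + 6 * D 0 v * D 7 v + 4 * Dinf v * D 7 v - 2 * D 1 v * D 6 v
      - 2 * D 2 v * D 5 v - 2 * D 8 v * D 12 v - 2 * D 9 v * D 11 v
  | 8, v => -2 * D 4 v ^ 2 + 6 * D 0 v * D 8 v + 4 * Dinf v * D 8 v - 2 * D 3 v * D 5 v
      - 2 * D 6 v * D 2 v - 2 * D 11 v * D 10 v - 2 * D 1 v * D 7 v
  | 9, v => -D 11 v ^ 2 + 2 * D 0 v * D 9 v + 10 * Dinf v * D 9 v + 2 * D 5 v * D 4 v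
      - 2 * D 1 v * D 8 v - 4 * D 10 v * D 12 v - 2 * D 3 v * D 6 v
  | 10, v => -D 5 v ^ 2 + 10 * D 0 v * D 10 v - 2 * Dinf v * D 10 v + 2 * D 6 v * D 4 v
      - 2 * D 3 v * D 7 v - 4 * D 9 v * D 1 v - 2 * D 12 v * D 11 v
  | 11, v => -2 * D 12 v ^ 2 + 6 * D 0 v * D 11 v + 4 * Dinf v * D 11 v - 2 * D 9 v * D 2 v
      - 2 * D 5 v * D 6 v - 2 * D 7 v * D 4 v - 2 * D 3 v * D 8 v
  | 12, v => -D 6 v ^ 2 + 10 * D 0 v * D 12 v - 2 * Dinf v * D 12 v + 2 * D 2 v * D 10 v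
      - 2 * D 1 v * D 11 v - 4 * D 3 v * D 9 v - 2 * D 4 v * D 8 v
  | _, _ => 0

/-- `δ_ν = −13·G0 + Σ_{j=1}^{12} ζ^{jν} G_j`. -/
def deltaF (ν : ℕ) (v : Fin 6 → ℂ) : ℂ :=
  -13 * Gs 0 v + ∑ j ∈ Finset.Icc 1 12, ζ ^ (j * ν) * Gs j v

/-- `δ_∞ = 13^2·G0`. -/
def deltaInf (v : Fin 6 → ℂ) : ℂ := 13 ^ 2 * Gs 0 v

/-- `Φ4 = Σ_ν w_ν + w_∞`. -/
def Phi4 (v : Fin 6 → ℂ) : ℂ := (∑ ν ∈ Finset.range 13, w ν v) + winf v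

/-- `Φ8 = Σ_ν w_ν^2 + w_∞^2`. -/
def Phi8 (v : Fin 6 → ℂ) : ℂ := (∑ ν ∈ Finset.range 13, w ν v ^ 2) + winf v ^ 2

/-- `Φ12′ = −(1/(13·30))(Σ_ν w_ν^3 + w_∞^3)`. -/
def Phi12' (v : Fin 6 → ℂ) : ℂ :=
  -(1 / (13 * 30)) * ((∑ ν ∈ Finset.range 13, w ν v ^ 3) + winf v ^ 3)

/-- `Φ16 = Σ_ν w_ν^4 + w_∞^4`. -/
def Phi16 (v : Fin 6 → ℂ) : ℂ := (∑ ν ∈ Finset.range 13, w ν v ^ 4) + winf v ^ 4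

/-- `Φ20 = (1/(13·25))(Σ_ν w_ν^5 + w_∞^5)`. -/
def Phi20 (v : Fin 6 → ℂ) : ℂ :=
  (1 / (13 * 25)) * ((∑ ν ∈ Finset.range 13, w ν v ^ 5) + winf v ^ 5)

/-- `Φ12 = −(1/(13·52))(Σ_ν δ_ν^2 + δ_∞^2)`. -/
def Phi12 (v : Fin 6 → ℂ) : ℂ :=
  -(1 / (13 * 52)) * ((∑ ν ∈ Finset.range 13, deltaF ν v ^ 2) + deltaInf v ^ 2)

/-- `Φ18 = (1/(13·6))(Σ_ν δ_ν^3 + δ_∞^3)`. -/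
def Phi18 (v : Fin 6 → ℂ) : ℂ :=
  (1 / (13 * 6)) * ((∑ ν ∈ Finset.range 13, deltaF ν v ^ 3) + deltaInf v ^ 3)

/-- `Φ30 = −(1/(13·1315))(Σ_ν δ_ν^5 + δ_∞^5)`. -/
def Phi30 (v : Fin 6 → ℂ) : ℂ :=
  -(1 / (13 * 1315)) * ((∑ ν ∈ Finset.range 13, deltaF ν v ^ 5) + deltaInf v ^ 5)

/-- `q^α = exp(2πiαz)`. -/
def qp (α : ℚ) (z : ℂ) : ℂ := Complex.exp (2 * Real.pi * Complex.I * (α : ℂ) * z)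

/-- `Σ_{n∈ℤ} (−1)^n q^{(13n^2+cn)/2}`. -/
def thetaSum (c : ℤ) (z : ℂ) : ℂ :=
  ∑' n : ℤ, (-1 : ℂ) ^ n * qp ((13 * (n : ℚ) ^ 2 + (c : ℚ) * (n : ℚ)) / 2) z

/-- The theta constants of order 13: `a_1, …, a_6`. -/
def thc : ℕ → ℂ → ℂ
  | 1, z => qp (121 / 104) z * thetaSum 11 z
  | 2, z => qp (49 / 104) z * thetaSum 7 z
  | 3, z => qp (25 / 104) z * thetaSum 5 z
  | 4, z => -(qp (9 / 104) z * thetaSum 3 z)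
  | 5, z => qp (81 / 104) z * thetaSum 9 z
  | 6, z => qp (1 / 104) z * thetaSum 1 z
  | _, _ => 0

/-- The vector `A(z) = (a1(z), …, a6(z))`. -/
def Avec (z : ℂ) : Fin 6 → ℂ := fun i => thc (i.val + 1) z

/-- The Dedekind eta function `η(z) = q^{1/24} Π_{n=1}^∞ (1−q^n)`. -/
def etaF (z : ℂ) : ℂ :=
  qp (1 / 24) z * ∏' n : ℕ, (1 - Complex.exp (2 * Real.pi * Complex.I * z) ^ (n + 1))

/-- The vector `(x1(z), …, x6(z))` with `x_i(z) = η(z)·a_i(z)`. -/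
def X (z : ℂ) : Fin 6 → ℂ := fun i => etaF z * thc (i.val + 1) z

/-- The discriminant `Δ(z) = η(z)^24`. -/
def Delta (z : ℂ) : ℂ := etaF z ^ 24

/-- The Eisenstein series `E4(z) = (1/2) Σ_{gcd(m,n)=1} (mz+n)^{−4}`. -/
def E4 (z : ℂ) : ℂ :=
  (1 / 2) * ∑' p : {p : ℤ × ℤ // Int.gcd p.1 p.2 = 1},
    ((p.1.1 : ℂ) * z + (p.1.2 : ℂ)) ^ (-4 : ℤ)

/-- The Eisenstein series `E6(z) = (1/2) Σ_{gcd(m,n)=1} (mz+n)^{−6}`. -/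
def E6 (z : ℂ) : ℂ :=
  (1 / 2) * ∑' p : {p : ℤ × ℤ // Int.gcd p.1 p.2 = 1},
    ((p.1.1 : ℂ) * z + (p.1.2 : ℂ)) ^ (-6 : ℤ)

/-- The coordinates of an odd function on `ℤ/13`, in the order `(1, 3, 9, 8, 11, 7)`. -/
def oddVec (V : ZMod 13 → ℂ) : Fin 6 → ℂ := ![V 1, V 3, V 9, V 8, V 11, V 7]

/-- The forms `A_j` as an even function on `ℤ/13`, the form `A_0` being doubled. -/
def formFn (v : Fin 6 → ℂ) : ZMod 13 → ℂ :=
  ![2 * A 0 v, A 1 v, A 2 v, A 3 v, A 4 v, A 5 v, A 6 v,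
    A 6 v, A 5 v, A 4 v, A 3 v, A 2 v, A 1 v]

/-- The Fourier transform on `ℤ/13`. -/
def fourier13 (V : ZMod 13 → ℂ) (x : ZMod 13) : ℂ := ∑ y, ZMod.stdAddChar (x * y) * V y

/-- Quadratic Gauss sum modulo `13`. -/
def gauss13 (ν : ZMod 13) : ℂ := ∑ x : ZMod 13, ZMod.stdAddChar (ν * x ^ 2)

theorem odd_values {V : ZMod 13 → ℂ} (hV : ∀ x, V (-x) = -V x) :
    V 0 = 0 ∧ V 2 = -V 11 ∧ V 4 = -V 9 ∧ V 5 = -V 8 ∧ V 6 = -V 7 ∧ V 10 = -V 3 ∧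
      V 12 = -V 1 := by
  refine ⟨?_, hV 11, hV 9, hV 8, hV 7, hV 3, hV 1⟩
  have := hV 0
  rw [neg_zero] at this
  linear_combination this / 2

theorem formFn_comp_mul_seven {V : ZMod 13 → ℂ} (hV : ∀ x, V (-x) = -V x) (y : ZMod 13) :
    formFn (oddVec fun x => V (7 * x)) y = -formFn (oddVec V) (7 * y) := by
  obtain ⟨h0, h2, h4, h5, h6, h10, h12⟩ := odd_values hV
  have e : oddVec (fun x => V (7 * x)) = ![V 7, V 8, V 11, V 4, V 12, V 10] := rfl
  rw [e, h4, h12, h10]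
  fin_cases y
  · change 2 * A 0 _ = -(2 * A 0 _)
    simp [A, oddVec]; ring
  · change A 1 _ = -A 6 _
    simp [A, oddVec]; ring
  · change A 2 _ = -A 1 _
    simp [A, oddVec]; ring
  · change A 3 _ = -A 5 _
    simp [A, oddVec]; ring
  · change A 4 _ = -A 2 _
    simp [A, oddVec]; ring
  · change A 5 _ = -A 4 _
    simp [A, oddVec]; ring
  · change A 6 _ = -A 3 _
    simp [A, oddVec]; ring
  · change A 6 _ = -A 3 _
    simp [A, oddVec]; ring
  · change A 5 _ = -A 4 _
    simp [A, oddVec]; ring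
  · change A 4 _ = -A 2 _
    simp [A, oddVec]; ring
  · change A 3 _ = -A 5 _
    simp [A, oddVec]; ring
  · change A 2 _ = -A 1 _
    simp [A, oddVec]; ring
  · change A 1 _ = -A 6 _
    simp [A, oddVec]; ring

theorem fourier13_neg {V : ZMod 13 → ℂ} (hV : ∀ x, V (-x) = -V x) (x : ZMod 13) :
    fourier13 V (-x) = -fourier13 V x := by
  unfold fourier13
  rw [← Finset.sum_neg_distrib, ← Equiv.sum_comp (Equiv.neg (ZMod 13))]
  refine Finset.sum_congr rfl fun y _ => ?_
  simp [hV]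

/-- `7` is invertible modulo `13`, with inverse `2`. -/
def mulSeven : ZMod 13 ≃ ZMod 13 where
  toFun x := 7 * x
  invFun x := 2 * x
  left_inv := by decide
  right_inv := by decide

theorem fourier13_comp_mul_seven (V : ZMod 13 → ℂ) (x : ZMod 13) :
    fourier13 (fun t => V (7 * t)) (7 * x) = fourier13 V x := by
  unfold fourier13
  conv_rhs => rw [← Equiv.sum_comp mulSeven]
  refine Finset.sum_congr rfl fun y _ => ?_
  rw [show 7 * x * y = x * mulSeven y by change _ = x * (7 * y); ring]
  rfl

/-- The matrix `s_{ρ_i ρ_j}`, where `ρ = (1, 3, 9, 8, 11, 7)`, applied to a vector. -/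
def sineVec (s : ZMod 13 → ℂ) (v : Fin 6 → ℂ) : Fin 6 → ℂ :=
  ![s 1 * v 0 + s 3 * v 1 - s 4 * v 2 - s 5 * v 3 - s 2 * v 4 - s 6 * v 5,
    s 3 * v 0 - s 4 * v 1 + s 1 * v 2 - s 2 * v 3 - s 6 * v 4 - s 5 * v 5,
    -s 4 * v 0 + s 1 * v 1 + s 3 * v 2 - s 6 * v 3 - s 5 * v 4 - s 2 * v 5,
    -s 5 * v 0 - s 2 * v 1 - s 6 * v 2 - s 1 * v 3 - s 3 * v 4 + s 4 * v 5,
    -s 2 * v 0 - s 6 * v 1 - s 5 * v 2 - s 3 * v 3 + s 4 * v 4 - s 1 * v 5,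
    -s 6 * v 0 - s 5 * v 1 - s 2 * v 2 + s 4 * v 3 - s 1 * v 4 - s 3 * v 5]

theorem sine_products {s c : ZMod 13 → ℂ} (hs : ∀ x y, s x * s y = c (x + y) - c (x - y))
    (hneg : ∀ x, c (-x) = c x) :
    s 1 * s 1 = c 2 - c 0 ∧ s 1 * s 2 = c 3 - c 1 ∧ s 1 * s 3 = c 4 - c 2 ∧
    s 1 * s 4 = c 5 - c 3 ∧ s 1 * s 5 = c 6 - c 4 ∧ s 1 * s 6 = c 6 - c 5 ∧
    s 2 * s 2 = c 4 - c 0 ∧ s 2 * s 3 = c 5 - c 1 ∧ s 2 * s 4 = c 6 - c 2 ∧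
    s 2 * s 5 = c 6 - c 3 ∧ s 2 * s 6 = c 5 - c 4 ∧ s 3 * s 3 = c 6 - c 0 ∧
    s 3 * s 4 = c 6 - c 1 ∧ s 3 * s 5 = c 5 - c 2 ∧ s 3 * s 6 = c 4 - c 3 ∧
    s 4 * s 4 = c 5 - c 0 ∧ s 4 * s 5 = c 4 - c 1 ∧ s 4 * s 6 = c 3 - c 2 ∧
    s 5 * s 5 = c 3 - c 0 ∧ s 5 * s 6 = c 2 - c 1 ∧ s 6 * s 6 = c 1 - c 0 := by
  have fold (x y : ZMod 13) (h : x = y ∨ x = -y) : c x = c y := by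
    rcases h with rfl | rfl
    · rfl
    · exact hneg y
  have smul (a b p m : ZMod 13) (hp : a + b = p ∨ a + b = -p) (hm : a - b = m ∨ a - b = -m) :
      s a * s b = c p - c m := by rw [hs, fold _ _ hp, fold _ _ hm]
  refine ⟨smul 1 1 2 0 ?_ ?_, smul 1 2 3 1 ?_ ?_, smul 1 3 4 2 ?_ ?_, smul 1 4 5 3 ?_ ?_,
    smul 1 5 6 4 ?_ ?_, smul 1 6 6 5 ?_ ?_, smul 2 2 4 0 ?_ ?_, smul 2 3 5 1 ?_ ?_,
    smul 2 4 6 2 ?_ ?_, smul 2 5 6 3 ?_ ?_, smul 2 6 5 4 ?_ ?_, smul 3 3 6 0 ?_ ?_,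
    smul 3 4 6 1 ?_ ?_, smul 3 5 5 2 ?_ ?_, smul 3 6 4 3 ?_ ?_, smul 4 4 5 0 ?_ ?_,
    smul 4 5 4 1 ?_ ?_, smul 4 6 3 2 ?_ ?_, smul 5 5 3 0 ?_ ?_, smul 5 6 2 1 ?_ ?_,
    smul 6 6 1 0 ?_ ?_⟩ <;> decide

theorem A_zero_sineVec {s c : ZMod 13 → ℂ} (hs : ∀ x y, s x * s y = c (x + y) - c (x - y))
    (hneg : ∀ x, c (-x) = c x) (h0 : c 0 = 2)
    (hsum : 1 + c 1 + c 2 + c 3 + c 4 + c 5 + c 6 = 0) (v : Fin 6 → ℂ) :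
    2 * A 0 (sineVec s v) =
      2 * (1 + 2 * (c 1 + c 3 + c 4)) * (A 0 v + A 1 v + A 2 v + A 3 v + A 4 v + A 5 v +
        A 6 v) := by
  obtain ⟨s11, s12, s13, s14, s15, s16, s22, s23, s24, s25, s26, s33, s34, s35, s36, s44, s45, s46,
    s55, s56, s66⟩ := sine_products hs hneg
  simp only [A, sineVec, Matrix.cons_val]
  rw [h0] at *
  linear_combination (-2 * v 0 * v 3 - 2 * v 1 * v 4 - 2 * v 2 * v 5) * s11 +
    (-2 * v 0 * v 1 - 2 * v 0 * v 2 - 2 * v 1 * v 2 + 2 * v 3 * v 4 + 2 * v 3 * v 5 +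
      2 * v 4 * v 5) * s12 +
    (-2 * v 0 * v 4 - 2 * v 0 * v 5 - 2 * v 1 * v 3 - 2 * v 1 * v 5 - 2 * v 2 * v 3 -
      2 * v 2 * v 4) * s13 +
    (2 * v 0 * v 4 + 2 * v 0 * v 5 + 2 * v 1 * v 3 + 2 * v 1 * v 5 + 2 * v 2 * v 3 +
      2 * v 2 * v 4) * s14 +
    (-2 * v 0 ^ 2 - 2 * v 1 ^ 2 - 2 * v 2 ^ 2 + 2 * v 3 ^ 2 + 2 * v 4 ^ 2 + 2 * v 5 ^ 2) * s15 +
    (-2 * v 0 * v 1 - 2 * v 0 * v 2 - 2 * v 1 * v 2 + 2 * v 3 * v 4 + 2 * v 3 * v 5 +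
      2 * v 4 * v 5) * s16 +
    (2 * v 0 * v 3 + 2 * v 1 * v 4 + 2 * v 2 * v 5) * s22 +
    (-2 * v 0 ^ 2 - 2 * v 1 ^ 2 - 2 * v 2 ^ 2 + 2 * v 3 ^ 2 + 2 * v 4 ^ 2 + 2 * v 5 ^ 2) * s23 +
    (2 * v 0 * v 1 + 2 * v 0 * v 2 + 2 * v 1 * v 2 - 2 * v 3 * v 4 - 2 * v 3 * v 5 -
      2 * v 4 * v 5) * s24 +
    (2 * v 0 * v 4 + 2 * v 0 * v 5 + 2 * v 1 * v 3 + 2 * v 1 * v 5 + 2 * v 2 * v 3 +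
      2 * v 2 * v 4) * s25 +
    (2 * v 0 * v 4 + 2 * v 0 * v 5 + 2 * v 1 * v 3 + 2 * v 1 * v 5 + 2 * v 2 * v 3 +
      2 * v 2 * v 4) * s26 +
    (-2 * v 0 * v 3 - 2 * v 1 * v 4 - 2 * v 2 * v 5) * s33 +
    (2 * v 0 * v 4 + 2 * v 0 * v 5 + 2 * v 1 * v 3 + 2 * v 1 * v 5 + 2 * v 2 * v 3 +
      2 * v 2 * v 4) * s34 +
    (-2 * v 0 * v 1 - 2 * v 0 * v 2 - 2 * v 1 * v 2 + 2 * v 3 * v 4 + 2 * v 3 * v 5 +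
      2 * v 4 * v 5) * s35 +
    (-2 * v 0 * v 1 - 2 * v 0 * v 2 - 2 * v 1 * v 2 + 2 * v 3 * v 4 + 2 * v 3 * v 5 +
      2 * v 4 * v 5) * s36 +
    (-2 * v 0 * v 3 - 2 * v 1 * v 4 - 2 * v 2 * v 5) * s44 +
    (2 * v 0 * v 1 + 2 * v 0 * v 2 + 2 * v 1 * v 2 - 2 * v 3 * v 4 - 2 * v 3 * v 5 -
      2 * v 4 * v 5) * s45 +
    (2 * v 0 ^ 2 + 2 * v 1 ^ 2 + 2 * v 2 ^ 2 - 2 * v 3 ^ 2 - 2 * v 4 ^ 2 - 2 * v 5 ^ 2) * s46 +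
    (2 * v 0 * v 3 + 2 * v 1 * v 4 + 2 * v 2 * v 5) * s55 +
    (2 * v 0 * v 4 + 2 * v 0 * v 5 + 2 * v 1 * v 3 + 2 * v 1 * v 5 + 2 * v 2 * v 3 +
      2 * v 2 * v 4) * s56 +
    (2 * v 0 * v 3 + 2 * v 1 * v 4 + 2 * v 2 * v 5) * s66 +
    (-2 * v 0 ^ 2 - 2 * v 0 * v 3 + 4 * v 0 * v 4 + 4 * v 0 * v 5 - 2 * v 1 ^ 2 +
      4 * v 1 * v 3 - 2 * v 1 * v 4 + 4 * v 1 * v 5 - 2 * v 2 ^ 2 + 4 * v 2 * v 3 +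
      4 * v 2 * v 4 - 2 * v 2 * v 5 + 2 * v 3 ^ 2 + 2 * v 4 ^ 2 + 2 * v 5 ^ 2) * hsum

theorem A_one_sineVec {s c : ZMod 13 → ℂ} (hs : ∀ x y, s x * s y = c (x + y) - c (x - y))
    (hc : ∀ x y, c x * c y = c (x + y) + c (x - y))
    (hneg : ∀ x, c (-x) = c x) (h0 : c 0 = 2)
    (hsum : 1 + c 1 + c 2 + c 3 + c 4 + c 5 + c 6 = 0) (v : Fin 6 → ℂ) :
    A 1 (sineVec s v) =
      (1 + 2 * (c 1 + c 3 + c 4)) * (2 * A 0 v + c 2 * A 1 v + c 4 * A 2 v + c 6 * A 3 v +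
        c 5 * A 4 v + c 3 * A 5 v + c 1 * A 6 v) := by
  have fold (x y : ZMod 13) (h : x = y ∨ x = -y) : c x = c y := by
    rcases h with rfl | rfl
    · rfl
    · exact hneg y
  have cmul (a b p m : ZMod 13) (hp : a + b = p ∨ a + b = -p) (hm : a - b = m ∨ a - b = -m) :
      c a * c b = c p + c m := by rw [hc, fold _ _ hp, fold _ _ hm]
  have c11 : c 1 * c 1 = c 2 + c 0 := cmul 1 1 2 0 (by decide) (by decide)
  have c12 : c 1 * c 2 = c 3 + c 1 := cmul 1 2 3 1 (by decide) (by decide)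
  have c13 : c 1 * c 3 = c 4 + c 2 := cmul 1 3 4 2 (by decide) (by decide)
  have c14 : c 1 * c 4 = c 5 + c 3 := cmul 1 4 5 3 (by decide) (by decide)
  have c15 : c 1 * c 5 = c 6 + c 4 := cmul 1 5 6 4 (by decide) (by decide)
  have c16 : c 1 * c 6 = c 6 + c 5 := cmul 1 6 6 5 (by decide) (by decide)
  have c31 : c 3 * c 1 = c 4 + c 2 := cmul 3 1 4 2 (by decide) (by decide)
  have c32 : c 3 * c 2 = c 5 + c 1 := cmul 3 2 5 1 (by decide) (by decide)
  have c33 : c 3 * c 3 = c 6 + c 0 := cmul 3 3 6 0 (by decide) (by decide)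
  have c34 : c 3 * c 4 = c 6 + c 1 := cmul 3 4 6 1 (by decide) (by decide)
  have c35 : c 3 * c 5 = c 5 + c 2 := cmul 3 5 5 2 (by decide) (by decide)
  have c36 : c 3 * c 6 = c 4 + c 3 := cmul 3 6 4 3 (by decide) (by decide)
  have c41 : c 4 * c 1 = c 5 + c 3 := cmul 4 1 5 3 (by decide) (by decide)
  have c42 : c 4 * c 2 = c 6 + c 2 := cmul 4 2 6 2 (by decide) (by decide)
  have c43 : c 4 * c 3 = c 6 + c 1 := cmul 4 3 6 1 (by decide) (by decide)
  have c44 : c 4 * c 4 = c 5 + c 0 := cmul 4 4 5 0 (by decide) (by decide)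
  have c45 : c 4 * c 5 = c 4 + c 1 := cmul 4 5 4 1 (by decide) (by decide)
  have c46 : c 4 * c 6 = c 3 + c 2 := cmul 4 6 3 2 (by decide) (by decide)
  obtain ⟨s11, s12, s13, s14, s15, s16, s22, s23, s24, s25, s26, s33, s34, s35, s36, s44, s45, s46,
    s55, s56, s66⟩ := sine_products hs hneg
  simp only [A, sineVec, Matrix.cons_val]
  rw [h0] at *
  linear_combination (v 0 ^ 2 + 2 * v 1 * v 3) * s11 +
    (-2 * v 0 * v 4 + 2 * v 1 ^ 2 - 2 * v 3 * v 5) * s12 +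
    (2 * v 0 * v 1 + 2 * v 1 * v 4 + 2 * v 2 * v 3) * s13 +
    (-2 * v 0 * v 2 - 2 * v 0 * v 3 - 2 * v 1 * v 5) * s14 +
    (2 * v 0 * v 1 - 2 * v 0 * v 3 - 2 * v 3 * v 4) * s15 +
    (-2 * v 0 * v 5 + 2 * v 1 * v 2 - 2 * v 3 ^ 2) * s16 + (-2 * v 1 * v 5 + v 4 ^ 2) * s22 +
    (2 * v 1 * v 2 - 2 * v 1 * v 4 - 2 * v 4 * v 5) * s23 +
    (-2 * v 0 * v 1 + 2 * v 2 * v 4 + 2 * v 5 ^ 2) * s24 +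
    (-2 * v 0 * v 5 - 2 * v 1 * v 4 + 2 * v 3 * v 4) * s25 +
    (-2 * v 1 * v 3 - 2 * v 2 * v 5 + 2 * v 4 * v 5) * s26 + (v 1 ^ 2 + 2 * v 2 * v 4) * s33 +
    (-2 * v 0 * v 4 - 2 * v 1 * v 2 - 2 * v 2 * v 5) * s34 +
    (2 * v 0 * v 2 - 2 * v 1 * v 3 - 2 * v 4 ^ 2) * s35 +
    (-2 * v 1 * v 5 + 2 * v 2 ^ 2 - 2 * v 3 * v 4) * s36 + (2 * v 0 * v 5 + v 2 ^ 2) * s44 +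
    (-2 * v 0 ^ 2 + 2 * v 2 * v 3 + 2 * v 4 * v 5) * s45 +
    (-2 * v 0 * v 2 + 2 * v 2 * v 5 + 2 * v 3 * v 5) * s46 + (-2 * v 0 * v 4 + v 3 ^ 2) * s55 +
    (-2 * v 0 * v 3 - 2 * v 2 * v 4 + 2 * v 3 * v 5) * s56 + (-2 * v 2 * v 3 + v 5 ^ 2) * s66 +
    (4 * v 2 * v 4 + 2 * v 5 ^ 2) * c11 + (-2 * v 0 ^ 2 + 4 * v 2 * v 3) * c12 +
    (4 * v 0 * v 5 + 2 * v 3 ^ 2) * c13 + (4 * v 1 * v 3 + 2 * v 4 ^ 2) * c14 +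
    (4 * v 1 * v 5 - 2 * v 2 ^ 2) * c15 + (4 * v 0 * v 4 - 2 * v 1 ^ 2) * c16 +
    (4 * v 2 * v 4 + 2 * v 5 ^ 2) * c31 + (-2 * v 0 ^ 2 + 4 * v 2 * v 3) * c32 +
    (4 * v 0 * v 5 + 2 * v 3 ^ 2) * c33 + (4 * v 1 * v 3 + 2 * v 4 ^ 2) * c34 +
    (4 * v 1 * v 5 - 2 * v 2 ^ 2) * c35 + (4 * v 0 * v 4 - 2 * v 1 ^ 2) * c36 +
    (4 * v 2 * v 4 + 2 * v 5 ^ 2) * c41 + (-2 * v 0 ^ 2 + 4 * v 2 * v 3) * c42 +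
    (4 * v 0 * v 5 + 2 * v 3 ^ 2) * c43 + (4 * v 1 * v 3 + 2 * v 4 ^ 2) * c44 +
    (4 * v 1 * v 5 - 2 * v 2 ^ 2) * c45 + (4 * v 0 * v 4 - 2 * v 1 ^ 2) * c46 +
    (-2 * v 0 ^ 2 - 2 * v 0 * v 3 + 4 * v 0 * v 4 + 4 * v 0 * v 5 - 2 * v 1 ^ 2 +
      4 * v 1 * v 3 - 2 * v 1 * v 4 + 4 * v 1 * v 5 - 2 * v 2 ^ 2 + 4 * v 2 * v 3 +
      4 * v 2 * v 4 - 2 * v 2 * v 5 + 2 * v 3 ^ 2 + 2 * v 4 ^ 2 + 2 * v 5 ^ 2) * hsum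

local notation "e" => ZMod.stdAddChar (N := 13)

theorem sum_zmod13 (f : ZMod 13 → ℂ) :
    ∑ x, f x = f 0 + f 1 + f 2 + f 3 + f 4 + f 5 + f 6 + f 7 + f 8 + f 9 + f 10 + f 11 + f 12 := by
  have h (f : Fin 13 → ℂ) : ∑ x, f x =
      f 0 + f 1 + f 2 + f 3 + f 4 + f 5 + f 6 + f 7 + f 8 + f 9 + f 10 + f 11 + f 12 := by
    simp only [Fin.sum_univ_castSucc, Fin.sum_univ_zero, zero_add]
    rfl
  exact h f

theorem oddVec_fourier13 {V : ZMod 13 → ℂ} (hV : ∀ x, V (-x) = -V x) :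
    oddVec (fourier13 V) = sineVec (fun x => e x - e (-x)) (oddVec V) := by
  obtain ⟨h0, h2, h4, h5, h6, h10, h12⟩ := odd_values hV
  set S : ZMod 13 → ℂ := fun x => e x - e (-x) with hS
  have hSneg (x : ZMod 13) : S (-x) = -S x := by simp [hS]
  obtain ⟨-, g2, g4, g5, g6, g10, g12⟩ := odd_values hSneg
  have key (x : ZMod 13) : fourier13 V x = S x * V 1 + S (3 * x) * V 3
      + S (9 * x) * V 9 + S (8 * x) * V 8 + S (11 * x) * V 11 + S (7 * x) * V 7 := by
    unfold fourier13
    rw [sum_zmod13, h0, h2, h4, h5, h6, h10, h12]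
    have (a b : ZMod 13) (h : -b = a) : x * a = -(b * x) := by rw [← h]; ring
    rw [this 2 11 rfl, this 4 9 rfl, this 5 8 rfl, this 6 7 rfl, this 10 3 rfl, this 12 1 rfl,
      mul_comm x 3, mul_comm x 7, mul_comm x 8, mul_comm x 9, mul_comm x 11, mul_one, one_mul]
    ring
  simp only [oddVec, sineVec, key, Matrix.cons_val]
  reduce_mod_char
  simp only [g2, g4, g5, g6, g10, g12]
  ext i
  fin_cases i <;> simp

theorem gauss13_one : gauss13 1 = 1 + 2 * ((e 1 + e (-1)) + (e 3 + e (-3)) + (e 4 + e (-4))) := by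
  unfold gauss13
  rw [sum_zmod13]
  reduce_mod_char
  rw [AddChar.map_zero_eq_one]
  ring

theorem stdAddChar_mul_sub_mul (x y : ZMod 13) :
    (e x - e (-x)) * (e y - e (-y)) =
      (e (x + y) + e (-(x + y))) - (e (x - y) + e (-(x - y))) := by
  simp only [neg_add, sub_eq_add_neg, AddChar.map_add_eq_mul, neg_neg]
  ring

theorem stdAddChar_mul_add_mul (x y : ZMod 13) :
    (e x + e (-x)) * (e y + e (-y)) =
      (e (x + y) + e (-(x + y))) + (e (x - y) + e (-(x - y))) := by
  simp only [neg_add, sub_eq_add_neg, AddChar.map_add_eq_mul, neg_neg]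
  ring

theorem sum_stdAddChar_pairs :
    1 + (e 1 + e (-1)) + (e 2 + e (-2)) + (e 3 + e (-3)) + (e 4 + e (-4)) + (e 5 + e (-5)) +
      (e 6 + e (-6)) = 0 := by
  have h := AddChar.sum_mulShift (1 : ZMod 13) (ZMod.isPrimitive_stdAddChar 13)
  rw [if_neg (by decide), Nat.cast_zero] at h
  simp only [mul_one] at h
  rw [sum_zmod13, AddChar.map_zero_eq_one] at h
  reduce_mod_char
  linear_combination h

/-- The forms `A_j` of the Fourier transform of an odd function. -/
def FourierRel (V : ZMod 13 → ℂ) (y : ZMod 13) : Prop :=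
  formFn (oddVec (fourier13 V)) y = gauss13 1 * ∑ x, e (2 * x * y) * formFn (oddVec V) x

theorem fourierRel_zero {V : ZMod 13 → ℂ} (hV : ∀ x, V (-x) = -V x) : FourierRel V 0 := by
  unfold FourierRel
  have h := A_zero_sineVec (c := fun x => e x + e (-x)) stdAddChar_mul_sub_mul
    (fun x => by rw [neg_neg, add_comm])
    (by simp only [neg_zero, AddChar.map_zero_eq_one]; norm_num) sum_stdAddChar_pairs (oddVec V)
  rw [← oddVec_fourier13 hV, ← gauss13_one] at h
  simp only [mul_zero, AddChar.map_zero_eq_one, one_mul]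
  rw [sum_zmod13]
  refine h.trans ?_
  change _ = _ * (2 * A 0 _ + A 1 _ + A 2 _ + A 3 _ + A 4 _ + A 5 _ + A 6 _ + A 6 _ + A 5 _ +
    A 4 _ + A 3 _ + A 2 _ + A 1 _)
  ring

theorem fourierRel_one {V : ZMod 13 → ℂ} (hV : ∀ x, V (-x) = -V x) : FourierRel V 1 := by
  unfold FourierRel
  have h := A_one_sineVec (c := fun x => e x + e (-x)) stdAddChar_mul_sub_mul stdAddChar_mul_add_mul
    (fun x => by rw [neg_neg, add_comm])
    (by simp only [neg_zero, AddChar.map_zero_eq_one]; norm_num) sum_stdAddChar_pairs (oddVec V)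
  rw [← oddVec_fourier13 hV, ← gauss13_one] at h
  rw [sum_zmod13]
  refine h.trans ?_
  change _ = _ * (_ * (2 * A 0 _) + _ * A 1 _ + _ * A 2 _ + _ * A 3 _ + _ * A 4 _ + _ * A 5 _ +
    _ * A 6 _ + _ * A 6 _ + _ * A 5 _ + _ * A 4 _ + _ * A 3 _ + _ * A 2 _ + _ * A 1 _)
  reduce_mod_char
  rw [AddChar.map_zero_eq_one]
  ring

theorem FourierRel.comp_mul_seven {V : ZMod 13 → ℂ} (hV : ∀ x, V (-x) = -V x) {y : ZMod 13}
    (h : FourierRel V y) : FourierRel (fun x => V (7 * x)) (7 * y) := by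
  unfold FourierRel at *
  have hV' (x : ZMod 13) : V (7 * -x) = -V (7 * x) := by rw [mul_neg, hV]
  have e1 := formFn_comp_mul_seven (fourier13_neg (V := fun x => V (7 * x)) hV') y
  simp only [fourier13_comp_mul_seven] at e1
  rw [← neg_eq_iff_eq_neg] at e1
  rw [← e1, h, ← mul_neg, ← Finset.sum_neg_distrib, ← Equiv.sum_comp mulSeven]
  congr 1
  refine Finset.sum_congr rfl fun x _ => ?_
  rw [formFn_comp_mul_seven hV]
  change -(e (2 * (7 * x) * y) * formFn (oddVec V) (7 * x)) = _
  rw [mul_neg, show 2 * (7 * x) * y = 2 * x * (7 * y) by ring]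

theorem fourierRel {V : ZMod 13 → ℂ} (hV : ∀ x, V (-x) = -V x) (y : ZMod 13) :
    FourierRel V y := by
  have key (k : ℕ) : ∀ {V : ZMod 13 → ℂ}, (∀ x, V (-x) = -V x) → FourierRel V (7 ^ k) := by
    induction k with
    | zero => exact fun hV => by simpa using fourierRel_one hV
    | succ k ih =>
      intro V hV
      have h := (ih (V := fun x => V (2 * x)) fun x => by rw [mul_neg, hV]).comp_mul_seven
        fun x => by rw [mul_neg, hV]
      rw [← pow_succ'] at h
      have e2 (x : ZMod 13) : 2 * (7 * x) = x := mulSeven.left_inv x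
      simpa only [e2] using h
  have hy : y = 0 ∨ ∃ k : Fin 12, y = 7 ^ (k : ℕ) := by revert y; decide
  rcases hy with rfl | ⟨k, rfl⟩
  · exact fourierRel_zero hV
  · exact key k hV

instance fact_prime_thirteen : Fact (Nat.Prime 13) := ⟨by norm_num⟩

/-- Twice the linear combination of the `A_j` whose square is `w_ν`. -/
def twist (B : ZMod 13 → ℂ) (ν : ZMod 13) : ℂ := ∑ y, e (ν * y ^ 2) * B y

theorem stdAddChar_natCast (n : ℕ) : e (n : ZMod 13) = ζ ^ n := by
  have := ZMod.stdAddChar_coe (N := 13) n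
  push_cast at this
  rw [this, zeta13, ← Complex.exp_nat_mul]
  congr 1
  ring

theorem w_eq (n : ℕ) (v : Fin 6 → ℂ) : w n v = (twist (formFn v) n / 2) ^ 2 := by
  unfold w twist
  simp only [← stdAddChar_natCast]
  rw [sum_zmod13]
  change _ = ((_ * (2 * A 0 _) + _ * A 1 _ + _ * A 2 _ + _ * A 3 _ + _ * A 4 _ + _ * A 5 _ +
    _ * A 6 _ + _ * A 6 _ + _ * A 5 _ + _ * A 4 _ + _ * A 3 _ + _ * A 2 _ + _ * A 1 _) / 2) ^ 2
  push_cast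
  reduce_mod_char
  rw [AddChar.map_zero_eq_one]
  ring_nf

theorem gauss13_sq {ν : ZMod 13} (hν : ν ≠ 0) : gauss13 ν ^ 2 = 13 := by
  have h5 : (5 : ZMod 13) * 5 = -1 := by decide
  calc gauss13 ν ^ 2 = ∑ y, ∑ x, e (ν * x ^ 2) * e (ν * y ^ 2) := by
        simp only [gauss13, sq (∑ x, _), Finset.sum_mul_sum]
        exact Finset.sum_comm
    _ = ∑ y, ∑ x, e (x * (ν * x + 10 * ν * y)) := by
        refine Finset.sum_congr rfl fun y _ => ?_
        rw [← Equiv.sum_comp (Equiv.addRight (5 * y))]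
        refine Finset.sum_congr rfl fun x _ => ?_
        rw [← AddChar.map_add_eq_mul, Equiv.coe_addRight]
        congr 1
        linear_combination ν * y ^ 2 * h5
    _ = ∑ x, e (ν * x ^ 2) * ∑ y, e (y * (10 * ν * x)) := by
        rw [Finset.sum_comm]
        refine Finset.sum_congr rfl fun x _ => ?_
        rw [Finset.mul_sum]
        refine Finset.sum_congr rfl fun y _ => ?_
        rw [← AddChar.map_add_eq_mul]
        congr 1
        ring
    _ = 13 := by
        simp only [AddChar.sum_mulShift _ (ZMod.isPrimitive_stdAddChar 13)]
        rw [Fintype.sum_eq_single 0]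
        · simp [ZMod.card]
        · intro x hx
          have : (10 : ZMod 13) ≠ 0 := by decide
          simp [hx, hν, this]

theorem twist_transform {B B' : ZMod 13 → ℂ}
    (h : ∀ y, B' y = gauss13 1 * ∑ x, e (2 * x * y) * B x) {ν : ZMod 13} (hν : ν ≠ 0) :
    twist B' ν = gauss13 1 * gauss13 ν * twist B (-ν⁻¹) := by
  have key (x : ZMod 13) :
      ∑ y, e (ν * y ^ 2) * e (2 * x * y) = gauss13 ν * e (-ν⁻¹ * x ^ 2) := by
    rw [gauss13, Finset.sum_mul, ← Equiv.sum_comp (Equiv.subRight (ν⁻¹ * x))]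
    refine Finset.sum_congr rfl fun y _ => ?_
    rw [← AddChar.map_add_eq_mul, ← AddChar.map_add_eq_mul, Equiv.subRight_apply]
    congr 1
    field_simp
    ring
  calc twist B' ν = gauss13 1 * ∑ y, ∑ x, e (ν * y ^ 2) * e (2 * x * y) * B x := by
        rw [twist, Finset.mul_sum]
        refine Finset.sum_congr rfl fun y _ => ?_
        simp only [h, mul_assoc]
        rw [← Finset.mul_sum, mul_left_comm]
    _ = _ := by
        rw [Finset.sum_comm]
        simp only [← Finset.sum_mul, key]
        rw [twist, mul_assoc (gauss13 1), Finset.mul_sum (a := gauss13 ν)]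
        simp only [mul_assoc]

theorem twist_zero_transform {B B' : ZMod 13 → ℂ}
    (h : ∀ y, B' y = gauss13 1 * ∑ x, e (2 * x * y) * B x) :
    twist B' 0 = 13 * gauss13 1 * B 0 := by
  simp only [twist, zero_mul, AddChar.map_zero_eq_one, one_mul, h]
  rw [← Finset.mul_sum, Finset.sum_comm, Fintype.sum_eq_single 0]
  · simp [ZMod.card]; ring
  · intro x hx
    rw [← Finset.sum_mul]
    simp only [mul_comm (2 * x)]
    have h2 : (2 : ZMod 13) ≠ 0 := by decide
    rw [AddChar.sum_mulShift _ (ZMod.isPrimitive_stdAddChar 13), if_neg (by simp [hx, h2])]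
    simp

/-- `Φ12′` in terms of the forms on `ℤ/13`. -/
def sextic (B : ZMod 13 → ℂ) : ℂ := ∑ ν, twist B ν ^ 6 + 13 ^ 3 * B 0 ^ 6

theorem Phi12'_eq (v : Fin 6 → ℂ) :
    Phi12' v = -(1 / (13 * 30)) * (sextic (formFn v) / 64) := by
  rw [Phi12', sextic, winf]
  have h1 : ∑ ν ∈ range 13, w ν v ^ 3 = (∑ ν, twist (formFn v) ν ^ 6) / 64 := by
    rw [sum_zmod13]
    simp only [Finset.sum_range_succ, Finset.sum_range_zero, w_eq]
    push_cast
    ring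
  have h2 : formFn v 0 = 2 * A 0 v := rfl
  rw [h1, h2]
  ring

theorem sextic_transform {B B' : ZMod 13 → ℂ}
    (h : ∀ y, B' y = gauss13 1 * ∑ x, e (2 * x * y) * B x) :
    sextic B' = 13 ^ 6 * sextic B := by
  let σ : ZMod 13 ≃ ZMod 13 := Function.Involutive.toPerm (fun ν => -ν⁻¹) fun ν => by simp
  have hσ (ν : ZMod 13) : σ ν = -ν⁻¹ := rfl
  have g6 {ν : ZMod 13} (hν : ν ≠ 0) : gauss13 ν ^ 6 = 13 ^ 3 := by
    rw [show 6 = 2 * 3 from rfl, pow_mul, gauss13_sq hν]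
  have h1 : ∑ ν, (twist B' ν ^ 6 - 13 ^ 6 * twist B (σ ν) ^ 6) =
      13 ^ 6 * (13 ^ 3 * B 0 ^ 6) - 13 ^ 6 * twist B 0 ^ 6 := by
    rw [Fintype.sum_eq_single 0]
    · rw [twist_zero_transform h, hσ, inv_zero, neg_zero, mul_pow, mul_pow, g6 one_ne_zero]
      ring
    · intro ν hν
      rw [twist_transform h hν, hσ, mul_pow, mul_pow, g6 one_ne_zero, g6 hν]
      ring
  have h0 : B' 0 = gauss13 1 * twist B 0 := by
    simp [h, twist]
  rw [Finset.sum_sub_distrib, ← Finset.mul_sum, Equiv.sum_comp σ fun ν => twist B ν ^ 6] at h1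
  rw [sextic, sextic, h0, mul_pow, g6 one_ne_zero]
  linear_combination h1

theorem Phi12'_fourier13 {V : ZMod 13 → ℂ} (hV : ∀ x, V (-x) = -V x) :
    Phi12' (oddVec (fourier13 V)) = 13 ^ 6 * Phi12' (oddVec V) := by
  rw [Phi12'_eq, Phi12'_eq, sextic_transform fun y => fourierRel hV y]
  ring

theorem sextic_shift (a : ℂ) (B : ZMod 13 → ℂ) :
    sextic (fun y => a * e (y ^ 2) * B y) = a ^ 6 * sextic B := by
  have h (ν : ZMod 13) : twist (fun y => a * e (y ^ 2) * B y) ν = a * twist B (ν + 1) := by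
    rw [twist, twist, Finset.mul_sum]
    refine Finset.sum_congr rfl fun y _ => ?_
    rw [add_mul, one_mul, AddChar.map_add_eq_mul]
    ring
  simp only [sextic, h, mul_pow, ← Finset.mul_sum]
  have h1 := Equiv.sum_comp (Equiv.addRight (1 : ZMod 13)) fun ν => twist B ν ^ 6
  simp only [Equiv.coe_addRight] at h1
  rw [h1, zero_pow two_ne_zero, AddChar.map_zero_eq_one]
  ring

theorem Phi12'_smul (a : ℂ) (v : Fin 6 → ℂ) : Phi12' (fun i => a * v i) = a ^ 12 * Phi12' v := by
  have hA (j : ℕ) : A j (fun i => a * v i) = a ^ 2 * A j v := by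
    unfold A
    split <;> ring
  have hw (ν : ℕ) : w ν (fun i => a * v i) = a ^ 4 * w ν v := by
    simp only [w, hA]; ring
  simp only [Phi12', hw, winf, hA, mul_pow, ← Finset.mul_sum]
  ring

theorem neg_one_zpow_eq_exp (k : ℤ) : (-1 : ℂ) ^ k = Complex.exp (Real.pi * I * k) := by
  rw [mul_comm, Complex.exp_int_mul, Complex.exp_pi_mul_I]

/-- The terms of the theta series `Σ_k (−1)^k exp(πi (2k+13)² z/52)`. -/
def thetaTerm (z : ℂ) (k : ℤ) : ℂ :=
  (-1) ^ k * Complex.exp (Real.pi * I * (2 * k + 13) ^ 2 / 52 * z)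

theorem thetaTerm_mul_stdAddChar (z : ℂ) (x k : ℤ) :
    e (x * k) * thetaTerm z k =
      Complex.exp (13 * Real.pi * I * z / 4) * jacobiTheta₂_term k (1 / 2 + z / 2 + x / 13) (z /
        13) := by
  have h := ZMod.stdAddChar_coe (N := 13) (x * k)
  push_cast at h
  rw [thetaTerm, jacobiTheta₂_term, h, neg_one_zpow_eq_exp, ← Complex.exp_add, ← Complex.exp_add,
    ← Complex.exp_add]
  congr 1
  ring

theorem summable_thetaTerm {z : ℂ} (hz : 0 < z.im) : Summable (thetaTerm z) := by
  have h : 0 < (z / 13).im := by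
    rw [show (13 : ℂ) = (13 : ℝ) by norm_num, Complex.div_ofReal_im]
    positivity
  have h1 := ((summable_jacobiTheta₂_term_iff (1 / 2 + z / 2 + (0 : ℤ) / 13) (z / 13)).2 h).mul_left
    (Complex.exp (13 * Real.pi * I * z / 4))
  refine h1.congr fun k => ?_
  rw [← thetaTerm_mul_stdAddChar]
  simp

/-- The theta constants of order `13` as an odd function on `ℤ/13`. -/
def thetaFn (z : ℂ) (x : ZMod 13) : ℂ := ∑' k : ℤ, if (k : ZMod 13) = x then thetaTerm z k else 0

theorem thetaFn_neg (z : ℂ) (x : ZMod 13) : thetaFn z (-x) = -thetaFn z x := by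
  rw [thetaFn, thetaFn, ← tsum_neg, ← (Equiv.subLeft (-13 : ℤ)).tsum_eq]
  refine tsum_congr fun k => ?_
  have h : ((-13 - k : ℤ) : ZMod 13) = -(k : ZMod 13) := by
    push_cast
    reduce_mod_char
  have ht : thetaTerm z (-13 - k) = -thetaTerm z k := by
    rw [thetaTerm, thetaTerm, show -13 - k = -(13 + k) by ring, zpow_neg, zpow_add₀ (by norm_num),
      mul_inv, ← inv_zpow, ← inv_zpow, inv_neg_one, show (-1 : ℂ) ^ (13 : ℤ) = -1 by norm_num]
    push_cast
    rw [show (2 * (-(13 + k : ℂ)) + 13) ^ 2 = (2 * k + 13) ^ 2 by ring]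
    ring
  simp only [Equiv.subLeft_apply, h, neg_inj, ht]
  split_ifs <;> simp

theorem thetaFn_fourier {z : ℂ} (hz : 0 < z.im) (x : ℤ) :
    fourier13 (thetaFn z) x =
      Complex.exp (13 * Real.pi * I * z / 4) * jacobiTheta₂ (1 / 2 + z / 2 + x / 13) (z / 13) := by
  have hs (y : ZMod 13) :
      Summable fun k : ℤ => e (x * y) * if (k : ZMod 13) = y then thetaTerm z k else 0 := by
    refine Summable.mul_left _ (((summable_thetaTerm hz).indicator {k : ℤ |
      (k : ZMod 13) = y}).congr
      fun k => ?_)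
    simp [Set.indicator_apply]
  simp only [fourier13, thetaFn, ← tsum_mul_left]
  rw [← Summable.tsum_finsetSum fun y _ => hs y, jacobiTheta₂, ← tsum_mul_left]
  refine tsum_congr fun k => ?_
  rw [← thetaTerm_mul_stdAddChar]
  simp

theorem thetaFn_intCast (z : ℂ) (m : ℤ) :
    thetaFn z m = (-1) ^ m * Complex.exp (Real.pi * I * (2 * m + 13) ^ 2 / 52 * z) *
      jacobiTheta₂ (1 / 2 + (2 * m + 13) * z / 2) (13 * z) := by
  have hi : Function.Injective fun n : ℤ => 13 * n + m := fun a b h => by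
    simp only at h
    omega
  rw [thetaFn, ← hi.tsum_eq, jacobiTheta₂, ← tsum_mul_left]
  · refine tsum_congr fun n => ?_
    have h13 : ((13 : ℤ) : ZMod 13) = 0 := rfl
    rw [if_pos (by push_cast; reduce_mod_char), thetaTerm, jacobiTheta₂_term, zpow_add₀
      (by norm_num),
      zpow_mul, show (-1 : ℂ) ^ (13 : ℤ) = -1 by norm_num, neg_one_zpow_eq_exp n]
    have : Complex.exp (Real.pi * I * (2 * (13 * n + m : ℤ) + 13) ^ 2 / 52 * z) =
        Complex.exp (Real.pi * I * (2 * m + 13) ^ 2 / 52 * z) *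
          Complex.exp (Real.pi * I * n * ((2 * m + 13) * z) + Real.pi * I * n ^ 2 * (13 * z)) := by
      rw [← Complex.exp_add]
      congr 1
      push_cast
      ring
    rw [this, show 2 * Real.pi * I * n * (1 / 2 + (2 * m + 13) * z / 2) +
      Real.pi * I * n ^ 2 * (13 * z) = Real.pi * I * n + (Real.pi * I * n * ((2 * m + 13) * z) +
        Real.pi * I * n ^ 2 * (13 * z)) by ring, Complex.exp_add (Real.pi * I * n)]
    ring
  · intro k hk
    have hk' : (k : ZMod 13) = m := by
      by_contra h
      simp [h] at hk
    obtain ⟨d, hd⟩ := (ZMod.intCast_eq_intCast_iff_dvd_sub k m 13).1 hk'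
    exact ⟨-d, by push_cast at hd; simp only; omega⟩

theorem jacobiTheta₂_add_natCast (w τ : ℂ) (n : ℕ) : jacobiTheta₂ (w + n) τ = jacobiTheta₂ w τ := by
  induction n with
  | zero => simp
  | succ n ih => rw [Nat.cast_succ, ← add_assoc, jacobiTheta₂_add_left, ih]

theorem thetaFn_S {z : ℂ} (hz : 0 < z.im) (x : ZMod 13) :
    fourier13 (thetaFn z) x =
      -I * (1 / (-I * (z / 13)) ^ (1 / 2 : ℂ)) * thetaFn (-1 / z) x := by
  have hz0 : z ≠ 0 := by rintro rfl; simp at hz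
  obtain ⟨m, rfl⟩ := ZMod.intCast_surjective x
  rw [thetaFn_fourier hz, thetaFn_intCast, jacobiTheta₂_functional_equation,
    show (1 / 2 + z / 2 + m / 13) / (z / 13) =
      -((1 / 2 + (2 * m + 13) * (-1 / z) / 2) - 7 + (0 : ℕ)) by field_simp; ring,
    jacobiTheta₂_neg_left, jacobiTheta₂_add_natCast, show -1 / (z / 13) = 13 * (-1 /
      z) by field_simp,
    ← jacobiTheta₂_add_natCast (_ - 7) _ 7, Nat.cast_ofNat, sub_add_cancel, neg_one_zpow_eq_exp]
  have h1 : Complex.exp (13 * Real.pi * I * z / 4) *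
      Complex.exp (-Real.pi * I * (1 / 2 + z / 2 + m / 13) ^ 2 / (z / 13)) =
      -I * (Complex.exp (Real.pi * I * m) *
        Complex.exp (Real.pi * I * (2 * m + 13) ^ 2 / 52 * (-1 / z))) := by
    have h2 : -I = Complex.exp (-(Real.pi / 2 * I)) := by
      rw [Complex.exp_neg, Complex.exp_pi_div_two_mul_I, Complex.inv_I]
    rw [h2, ← Complex.exp_add, ← Complex.exp_add, ← Complex.exp_add,
      Complex.exp_eq_exp_iff_exists_int]
    refine ⟨-3 - m, ?_⟩
    push_cast
    field_simp
    ring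
  linear_combination (1 / (-I * (z / 13)) ^ (1 / 2 : ℂ)) *
    jacobiTheta₂ (1 / 2 + (2 * m + 13) * (-1 / z) / 2) (13 * (-1 / z)) * h1

theorem thetaFn_T (z : ℂ) (x : ZMod 13) :
    thetaFn (z + 1) x = Complex.exp (13 * Real.pi * I / 4) * e (7 * x ^ 2) * thetaFn z x := by
  rw [thetaFn, thetaFn, ← tsum_mul_left]
  refine tsum_congr fun k => ?_
  split_ifs with h
  · obtain ⟨d, hd⟩ := Int.even_mul_succ_self k
    have h1 := ZMod.stdAddChar_coe (N := 13) (7 * k ^ 2)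
    push_cast at h1
    have h2 : Complex.exp (Real.pi * I * (2 * k + 13) ^ 2 / 52) =
        Complex.exp (13 * Real.pi * I / 4) * Complex.exp (2 * Real.pi * I * (7 * k ^ 2) / 13) := by
      rw [← Complex.exp_add, Complex.exp_eq_exp_iff_exists_int]
      refine ⟨k - d, ?_⟩
      have hd' : (k : ℂ) * (k + 1) = d + d := by exact_mod_cast hd
      push_cast
      linear_combination (-Real.pi * I) * hd'
    rw [← h, h1, thetaTerm, thetaTerm, mul_add, Complex.exp_add, mul_one, h2]
    ring
  · simp

theorem formFn_shift (a : ℂ) (V : ZMod 13 → ℂ) (y : ZMod 13) :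
    formFn (oddVec fun x => a * e (7 * x ^ 2) * V x) y =
      a ^ 2 * e (y ^ 2) * formFn (oddVec V) y := by
  have key (p q r : ZMod 13) (h : 7 * p ^ 2 + 7 * q ^ 2 = r) :
      a * e (7 * p ^ 2) * V p * (a * e (7 * q ^ 2) * V q) = a ^ 2 * e r * (V p * V q) := by
    rw [← h, AddChar.map_add_eq_mul]
    ring
  have main (j : ℕ) (r : ZMod 13) (hj : j < 7) (hr : r = (j : ZMod 13) ^ 2) :
      A j (oddVec fun x => a * e (7 * x ^ 2) * V x) = a ^ 2 * e r * A j (oddVec V) := by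
    interval_cases j <;> simp only [A, oddVec, Matrix.cons_val]
    · linear_combination key 1 8 r (by rw [hr]; rfl) + key 3 11 r (by rw [hr]; rfl) +
        key 9 7 r (by rw [hr]; rfl)
    · linear_combination key 1 1 r (by rw [hr]; rfl) - 2 * key 9 8 r (by rw [hr]; rfl)
    · linear_combination -key 11 11 r (by rw [hr]; rfl) - 2 * key 3 8 r (by rw [hr]; rfl)
    · linear_combination key 3 3 r (by rw [hr]; rfl) - 2 * key 1 11 r (by rw [hr]; rfl)
    · linear_combination key 9 9 r (by rw [hr]; rfl) - 2 * key 3 7 r (by rw [hr]; rfl)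
    · linear_combination -key 8 8 r (by rw [hr]; rfl) - 2 * key 1 7 r (by rw [hr]; rfl)
    · linear_combination -key 7 7 r (by rw [hr]; rfl) - 2 * key 9 11 r (by rw [hr]; rfl)
  fin_cases y
  · exact (congrArg (2 * ·) (main 0 (0 ^ 2) (by norm_num) rfl)).trans (mul_left_comm _ _ _)
  · exact main 1 _ (by norm_num) rfl
  · exact main 2 _ (by norm_num) rfl
  · exact main 3 _ (by norm_num) rfl
  · exact main 4 _ (by norm_num) rfl
  · exact main 5 _ (by norm_num) rfl
  · exact main 6 _ (by norm_num) rfl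
  · exact main 6 _ (by norm_num) rfl
  · exact main 5 _ (by norm_num) rfl
  · exact main 4 _ (by norm_num) rfl
  · exact main 3 _ (by norm_num) rfl
  · exact main 2 _ (by norm_num) rfl
  · exact main 1 _ (by norm_num) rfl

theorem Phi12'_thetaFn_add_one (z : ℂ) :
    Phi12' (oddVec (thetaFn (z + 1))) = -Phi12' (oddVec (thetaFn z)) := by
  have h1 : thetaFn (z + 1) =
      fun x => Complex.exp (13 * Real.pi * I / 4) * e (7 * x ^ 2) * thetaFn z x :=
    funext (thetaFn_T z)
  have h2 : (Complex.exp (13 * Real.pi * I / 4) ^ 2) ^ 6 = -1 := by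
    rw [← pow_mul, ← Complex.exp_nat_mul, ← Complex.exp_pi_mul_I, Complex.exp_eq_exp_iff_exists_int]
    refine ⟨19, ?_⟩
    push_cast
    ring
  rw [Phi12'_eq, Phi12'_eq, h1, funext (formFn_shift _ (thetaFn z)), sextic_shift, h2]
  ring

theorem oddVec_mul (a : ℂ) (V : ZMod 13 → ℂ) :
    oddVec (fun x => a * V x) = fun i => a * oddVec V i := by
  ext i
  fin_cases i <;> rfl

theorem Phi12'_thetaFn_S {z : ℂ} (hz : 0 < z.im) :
    Phi12' (oddVec (thetaFn (-1 / z))) = -z ^ 6 * Phi12' (oddVec (thetaFn z)) := by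
  have hz0 : z ≠ 0 := by rintro rfl; simp at hz
  have h := Phi12'_fourier13 (thetaFn_neg z)
  have hK : (-I * (1 / (-I * (z / 13)) ^ (1 / 2 : ℂ))) ^ 12 = -13 ^ 6 / z ^ 6 := by
    rw [mul_pow, div_pow, one_pow, ← Complex.cpow_nat_mul,
      show ((12 : ℕ) : ℂ) * (1 / 2) = (6 : ℕ) by norm_num, Complex.cpow_natCast, mul_pow, div_pow,
      neg_pow, neg_pow I 6, Complex.I_pow_eq_pow_mod, Complex.I_pow_eq_pow_mod 6]
    norm_num [neg_div]
  rw [funext (thetaFn_S hz), oddVec_mul, Phi12'_smul, hK] at h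
  rw [div_mul_eq_mul_div, div_eq_iff (pow_ne_zero 6 hz0)] at h
  linear_combination (-1 / 13 ^ 6) * h

theorem qp_mul_thetaSum (m : ℤ) {c : ℤ} (hc : c = 2 * m + 13) {α : ℚ} (hα : α = c ^ 2 / 104)
    (z : ℂ) :
    qp α z * thetaSum c z = (-1) ^ m * thetaFn z m := by
  subst hc hα
  rw [thetaFn_intCast, thetaSum, jacobiTheta₂, ← mul_assoc, ← mul_assoc, ← mul_zpow, neg_one_mul,
    neg_neg, one_zpow, one_mul]
  congr 1
  · rw [qp]
    congr 1
    push_cast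
    ring
  · refine tsum_congr fun n => ?_
    rw [qp, jacobiTheta₂_term, neg_one_zpow_eq_exp, ← Complex.exp_add]
    congr 1
    push_cast
    ring

theorem Avec_eq (z : ℂ) : Avec z = oddVec (thetaFn z) := by
  obtain ⟨-, h2, h4, h5, h6, -, -⟩ := odd_values (thetaFn_neg z)
  ext i
  fin_cases i
  · refine (qp_mul_thetaSum (-1) (c := 11) (by norm_num) (by norm_num) z).trans ?_
    push_cast
    norm_num [thetaFn_neg, oddVec]
  · refine (qp_mul_thetaSum (-3) (c := 7) (by norm_num) (by norm_num) z).trans ?_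
    push_cast
    norm_num [thetaFn_neg, oddVec]
  · refine (qp_mul_thetaSum (-4) (c := 5) (by norm_num) (by norm_num) z).trans ?_
    push_cast
    norm_num [thetaFn_neg, oddVec]
    rw [h4, neg_neg]
    rfl
  · refine (congrArg Neg.neg
      (qp_mul_thetaSum (-5) (c := 3) (by norm_num) (by norm_num) z)).trans ?_
    push_cast
    norm_num [thetaFn_neg, oddVec]
    rw [h5, neg_neg]
    rfl
  · refine (qp_mul_thetaSum (-2) (c := 9) (by norm_num) (by norm_num) z).trans ?_
    push_cast
    norm_num [thetaFn_neg, oddVec]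
    rw [h2, neg_neg]
    rfl
  · refine (qp_mul_thetaSum (-6) (c := 1) (by norm_num) (by norm_num) z).trans ?_
    push_cast
    norm_num [thetaFn_neg, oddVec]
    rw [h6, neg_neg]
    rfl

theorem etaF_eq (z : ℂ) : etaF z = ModularForm.eta z := by
  simp only [etaF, ModularForm.eta, ModularForm.eta_q_eq_pow]
  congr 1
  simp only [qp, Function.Periodic.qParam]
  congr 1
  push_cast
  ring

theorem isPrimitiveRoot_zeta13 : IsPrimitiveRoot ζ 13 := by
  simpa [zeta13] using Complex.isPrimitiveRoot_exp 13 (by norm_num)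

theorem sum_zeta13_pow_pow {k : ℕ} (hk : k.Coprime 13) : ∑ ν ∈ range 13, (ζ ^ ν) ^ k = 0 := by
  have h (ν : ℕ) : (ζ ^ ν) ^ k = (ζ ^ k) ^ ν := pow_right_comm ζ ν k
  simp only [h]
  exact (isPrimitiveRoot_zeta13.pow_of_coprime k hk).geom_sum_eq_zero (by norm_num)

theorem sum_zeta13_pow_pow_fiftytwo : ∑ ν ∈ range 13, (ζ ^ ν) ^ 52 = 13 := by
  have h (ν : ℕ) : (ζ ^ ν) ^ 52 = 1 := by
    rw [← pow_mul, mul_comm, show 52 * ν = 13 * (4 * ν) by ring, pow_mul,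
      isPrimitiveRoot_zeta13.pow_eq_one, one_pow]
  simp [h]

/-- The part of order at least six in `p` of `(x + p²y + p³u + p⁴v + p⁶r)⁶`, divided by `p⁶`. -/
def sixthPowTail (p x y u v r : ℂ) : ℂ :=
  6 * x ^ 5 * r + 15 * x ^ 4 * (u ^ 2 + 2 * y * (v + p ^ 2 * r) + 2 * p * u * (v + p ^ 2 * r) +
    p ^ 2 * (v + p ^ 2 * r) ^ 2) + 20 * x ^ 3 * (y + p * u + p ^ 2 * v + p ^ 4 * r) ^ 3 +
    15 * x ^ 2 * p ^ 2 * (y + p * u + p ^ 2 * v + p ^ 4 * r) ^ 4 +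
    6 * x * p ^ 4 * (y + p * u + p ^ 2 * v + p ^ 4 * r) ^ 5 +
    p ^ 6 * (y + p * u + p ^ 2 * v + p ^ 4 * r) ^ 6

theorem add_pow_six_eq_sixthPowTail (p x y u v r : ℂ) :
    (x + p ^ 2 * y + p ^ 3 * u + p ^ 4 * v + p ^ 6 * r) ^ 6 =
      x ^ 6 + 6 * x ^ 5 * y * p ^ 2 + 6 * x ^ 5 * u * p ^ 3 + 6 * x ^ 5 * v * p ^ 4 +
        15 * x ^ 4 * y ^ 2 * p ^ 4 + 30 * x ^ 4 * y * u * p ^ 5 +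
        p ^ 6 * sixthPowTail p x y u v r := by
  rw [sixthPowTail]
  ring

/-- The values of the theta constants at a point with nome `s = exp (2πiz/104)` in terms of the
values of the theta series. -/
def nomeVec (s : ℂ) (t : Fin 6 → ℂ) : Fin 6 → ℂ :=
  ![s ^ 121 * t 0, s ^ 49 * t 1, s ^ 25 * t 2, -(s ^ 9 * t 3), s ^ 81 * t 4, s * t 5]

/-- The form `A j` at `nomeVec s t`, divided by its leading power of `s`. -/
def nomeForm (s : ℂ) (t : Fin 6 → ℂ) : Fin 7 → ℂ :=
  ![t 2 * t 5 + s ^ 104 * (t 1 * t 4 - t 0 * t 3), 2 * t 2 * t 3 + s ^ 208 * t 0 ^ 2,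
    2 * t 1 * t 3 - s ^ 104 * t 4 ^ 2, t 1 ^ 2 - 2 * s ^ 104 * t 0 * t 4, t 2 ^ 2 - 2 * t 1 * t 5,
    -t 3 ^ 2 - 2 * s ^ 104 * t 0 * t 5, -t 5 ^ 2 - 2 * s ^ 104 * t 2 * t 4]

/-- The contribution of `w ν ^ 3` at `nomeVec s t` in degree at least `60` in `s`. -/
def nomeTail (s : ℂ) (t : Fin 6 → ℂ) (a : ℂ) : ℂ :=
  sixthPowTail (s ^ 8) (a ^ 10 * nomeForm s t 6) (a ^ 12 * nomeForm s t 5) (nomeForm s t 0)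
    (a * nomeForm s t 1)
    (a ^ 3 * nomeForm s t 4 + a ^ 4 * s ^ 8 * nomeForm s t 2 + a ^ 9 * s ^ 48 * nomeForm s t 3)

theorem continuous_nomeForm (j : Fin 7) :
    Continuous fun x : ℂ × (Fin 6 → ℂ) => nomeForm x.1 x.2 j := by
  fin_cases j <;> simp [nomeForm] <;> fun_prop

theorem continuous_nomeTail (a : ℂ) :
    Continuous fun x : ℂ × (Fin 6 → ℂ) => nomeTail x.1 x.2 a := by
  have h := continuous_nomeForm
  unfold nomeTail sixthPowTail
  fun_prop

theorem w_nomeVec_pow_three (s : ℂ) (t : Fin 6 → ℂ) (ν : ℕ) :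
    w ν (nomeVec s t) ^ 3 = s ^ 12 * (nomeForm s t 6 ^ 6 * (ζ ^ ν) ^ 60 +
      6 * nomeForm s t 6 ^ 5 * nomeForm s t 5 * s ^ 16 * (ζ ^ ν) ^ 62 +
      6 * nomeForm s t 6 ^ 5 * nomeForm s t 0 * s ^ 24 * (ζ ^ ν) ^ 50 +
      6 * nomeForm s t 6 ^ 5 * nomeForm s t 1 * s ^ 32 * (ζ ^ ν) ^ 51 +
      15 * nomeForm s t 6 ^ 4 * nomeForm s t 5 ^ 2 * s ^ 32 * (ζ ^ ν) ^ 64) +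
      s ^ 52 * (30 * nomeForm s t 6 ^ 4 * nomeForm s t 5 * nomeForm s t 0 * (ζ ^ ν) ^ 52 +
        s ^ 8 * nomeTail s t (ζ ^ ν)) := by
  set a := ζ ^ ν with ha
  have hw : w ν (nomeVec s t) = (s ^ 2 * (a ^ 10 * nomeForm s t 6 +
      (s ^ 8) ^ 2 * (a ^ 12 * nomeForm s t 5) + (s ^ 8) ^ 3 * nomeForm s t 0 +
      (s ^ 8) ^ 4 * (a * nomeForm s t 1) + (s ^ 8) ^ 6 * (a ^ 3 * nomeForm s t 4 +
        a ^ 4 * s ^ 8 * nomeForm s t 2 + a ^ 9 * s ^ 48 * nomeForm s t 3))) ^ 2 := by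
    simp only [w, A, pow_mul' ζ, ← ha, nomeVec, nomeForm, Matrix.cons_val]
    congr 1
    ring
  rw [hw, ← pow_mul, mul_pow, add_pow_six_eq_sixthPowTail, nomeTail]
  ring

/-- The quotient of `Phi12'` at `nomeVec s t` by `s ^ 52`. -/
def nomePhi (s : ℂ) (t : Fin 6 → ℂ) : ℂ :=
  -(1 / (13 * 30)) * (390 * nomeForm s t 6 ^ 4 * nomeForm s t 5 * nomeForm s t 0 +
    s ^ 8 * ∑ ν ∈ range 13, nomeTail s t (ζ ^ ν) + 13 ^ 3 * s ^ 104 * nomeForm s t 0 ^ 6)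

theorem Phi12'_nomeVec (s : ℂ) (t : Fin 6 → ℂ) :
    Phi12' (nomeVec s t) = s ^ 52 * nomePhi s t := by
  have hinf : winf (nomeVec s t) ^ 3 = s ^ 52 * (13 ^ 3 * s ^ 104 * nomeForm s t 0 ^ 6) := by
    simp only [winf, A, nomeVec, nomeForm, Matrix.cons_val]
    ring
  rw [Phi12', hinf, nomePhi]
  simp only [w_nomeVec_pow_three, sum_add_distrib, ← mul_sum]
  rw [sum_zeta13_pow_pow (by norm_num), sum_zeta13_pow_pow (by norm_num),
    sum_zeta13_pow_pow (by norm_num), sum_zeta13_pow_pow (by norm_num),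
    sum_zeta13_pow_pow (by norm_num), sum_zeta13_pow_pow_fiftytwo]
  ring

theorem continuous_nomePhi : Continuous fun x : ℂ × (Fin 6 → ℂ) => nomePhi x.1 x.2 := by
  have h := continuous_nomeForm
  have h' := continuous_nomeTail
  unfold nomePhi
  fun_prop

theorem nomePhi_zero_one : nomePhi 0 1 = 1 := by
  simp only [nomePhi, nomeForm, Matrix.cons_val]
  norm_num

open UpperHalfPlane hiding I
open Filter Topology MatrixGroups
open scoped ModularForm

theorem qp_natCast_div (k : ℕ) (N : ℚ) (z : ℂ) : qp (k / N) z = qp (1 / N) z ^ k := by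
  rw [qp, qp, ← Complex.exp_nat_mul]
  push_cast
  congr 1
  ring

theorem norm_qp (α : ℚ) (z : ℂ) : ‖qp α z‖ = Real.exp (-(2 * Real.pi * α * z.im)) := by
  rw [qp, Complex.norm_exp]
  congr 1
  simp [mul_assoc]

theorem tendsto_qp_atImInfty {α : ℚ} (hα : 0 < α) :
    Tendsto (fun z : ℍ => qp α z) atImInfty (𝓝 0) := by
  rw [tendsto_zero_iff_norm_tendsto_zero]
  simp only [norm_qp]
  have hα' : (0 : ℝ) < α := by exact_mod_cast hα
  have h : Tendsto (fun z : ℍ => 2 * Real.pi * α * z.im) atImInfty atTop :=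
    Tendsto.const_mul_atTop (by positivity) tendsto_comap
  exact Real.tendsto_exp_neg_atTop_nhds_zero.comp h

theorem eleven_mul_abs_le (n : ℤ) : 11 * |n| ≤ 13 * n ^ 2 := by
  rcases eq_or_ne n 0 with rfl | hn
  · simp
  · rw [← sq_abs]
    nlinarith [Int.one_le_abs hn]

theorem tendsto_thetaSum_atImInfty {c : ℤ} (hc : |c| ≤ 11) :
    Tendsto (fun z : ℍ => thetaSum c z) atImInfty (𝓝 1) := by
  have hle (n : ℤ) : 13 * n ^ 2 - 11 * |n| ≤ 13 * n ^ 2 + c * n := by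
    have := neg_abs_le (c * n)
    rw [abs_mul] at this
    nlinarith [abs_nonneg n]
  have hsum : Summable fun n : ℤ => Real.exp (-Real.pi * (13 * n ^ 2 - 2 * (11 / 2) * |n|)) := by
    simpa using summable_pow_mul_jacobiTheta₂_term_bound (11 / 2) (T := 13) (by norm_num) 0
  have hlim (n : ℤ) : Tendsto (fun z : ℍ => (-1 : ℂ) ^ n * qp ((13 * (n : ℚ) ^ 2 + c * n) / 2) z)
      atImInfty (𝓝 (if n = 0 then 1 else 0)) := by
    split_ifs with hn
    · simp [hn, qp]
    · have hpos : 0 < 13 * n ^ 2 + c * n := by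
        have h1 := Int.one_le_abs hn
        have h2 := hle n
        rw [← sq_abs] at h2 ⊢
        nlinarith
      have h := tendsto_qp_atImInfty (α := (13 * (n : ℚ) ^ 2 + c * n) / 2)
        (by have : (0 : ℚ) < 13 * n ^ 2 + c * n := by exact_mod_cast hpos
            positivity)
      simpa using h.const_mul ((-1 : ℂ) ^ n)
  have hbound : ∀ᶠ z : ℍ in atImInfty, ∀ n : ℤ,
      ‖(-1 : ℂ) ^ n * qp ((13 * (n : ℚ) ^ 2 + c * n) / 2) z‖ ≤
        Real.exp (-Real.pi * (13 * n ^ 2 - 2 * (11 / 2) * |n|)) := by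
    filter_upwards [tendsto_comap.eventually (eventually_ge_atTop (1 : ℝ))] with z hz n
    have hz : (1 : ℝ) ≤ (z : ℂ).im := hz
    have h1 : (13 * n ^ 2 - 11 * |n| : ℝ) ≤ 13 * n ^ 2 + c * n := by exact_mod_cast hle n
    have h2 : (11 * |n| : ℝ) ≤ 13 * n ^ 2 := by exact_mod_cast eleven_mul_abs_le n
    have h3 : (13 * n ^ 2 - 11 * |n| : ℝ) ≤ (13 * n ^ 2 + c * n) * (z : ℂ).im := by nlinarith
    rw [norm_mul, norm_zpow, norm_neg, norm_one, one_zpow, one_mul, norm_qp]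
    refine Real.exp_le_exp.2 ?_
    have h4 := mul_le_mul_of_nonneg_left h3 Real.pi_pos.le
    push_cast at h4 ⊢
    linarith
  have h := tendsto_tsum_of_dominated_convergence hsum hlim hbound
  simpa [thetaSum, tsum_ite_eq] using h

theorem Avec_eq_nomeVec (z : ℂ) : Avec z = nomeVec (qp (1 / 104) z)
    ![thetaSum 11 z, thetaSum 7 z, thetaSum 5 z, thetaSum 3 z, thetaSum 9 z, thetaSum 1 z] := by
  have h121 := qp_natCast_div 121 104 z
  have h49 := qp_natCast_div 49 104 z
  have h25 := qp_natCast_div 25 104 z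
  have h9 := qp_natCast_div 9 104 z
  have h81 := qp_natCast_div 81 104 z
  norm_num at h121 h49 h25 h9 h81
  ext i
  fin_cases i
  · exact congrArg (· * thetaSum 11 z) h121
  · exact congrArg (· * thetaSum 7 z) h49
  · exact congrArg (· * thetaSum 5 z) h25
  · exact congrArg (fun x => -(x * thetaSum 3 z)) h9
  · exact congrArg (· * thetaSum 9 z) h81
  · rfl

theorem Phi12'_X (z : ℂ) : Phi12' (X z) = etaF z ^ 12 * Phi12' (Avec z) :=
  Phi12'_smul (etaF z) (Avec z)

theorem tendsto_tprod_one_sub_pow :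
    Tendsto (fun q : ℂ => ∏' n : ℕ, (1 - q ^ (n + 1))) (𝓝 0) (𝓝 1) := by
  have h := tendsto_tprod_one_add_of_dominated_convergence (𝓕 := 𝓝 0) (g := 0)
    (f := fun (q : ℂ) (n : ℕ) => -q ^ (n + 1)) (bound := fun n => (1 / 2 : ℝ) ^ (n + 1))
  simp only [Pi.zero_apply, norm_neg, norm_pow, add_zero, tprod_one] at h
  simp_rw [sub_eq_add_neg]
  refine h
    (by simpa only [pow_succ'] using (summable_geometric_of_abs_lt_one (by norm_num)).mul_left _)
    (fun k => by simpa using ((continuous_pow (M := ℂ) (k + 1)).tendsto 0).neg) ?_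
  filter_upwards [Metric.ball_mem_nhds (0 : ℂ) (by norm_num : (0 : ℝ) < 1 / 2)] with q hq k
  exact pow_le_pow_left₀ (norm_nonneg _) (mem_ball_zero_iff.mp hq).le _

theorem tendsto_Phi12'_X_div_Delta :
    Tendsto (fun z : ℍ => Phi12' (X z) / Delta z) atImInfty (𝓝 1) := by
  set P : ℍ → ℂ := fun z => ∏' n : ℕ, (1 - Complex.exp (2 * Real.pi * I * z) ^ (n + 1))
  have hPlim : Tendsto P atImInfty (𝓝 1) := by
    have h := tendsto_tprod_one_sub_pow.comp (UpperHalfPlane.qParam_tendsto_atImInfty zero_lt_one)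
    simpa [Function.comp_def, Function.Periodic.qParam] using h
  set t : ℍ → Fin 6 → ℂ := fun z =>
    ![thetaSum 11 z, thetaSum 7 z, thetaSum 5 z, thetaSum 3 z, thetaSum 9 z, thetaSum 1 z] with ht
  have htlim : Tendsto t atImInfty (𝓝 1) := by
    rw [tendsto_pi_nhds]
    intro i
    fin_cases i
    · exact tendsto_thetaSum_atImInfty (c := 11) (by norm_num)
    · exact tendsto_thetaSum_atImInfty (c := 7) (by norm_num)
    · exact tendsto_thetaSum_atImInfty (c := 5) (by norm_num)
    · exact tendsto_thetaSum_atImInfty (c := 3) (by norm_num)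
    · exact tendsto_thetaSum_atImInfty (c := 9) (by norm_num)
    · exact tendsto_thetaSum_atImInfty (c := 1) (by norm_num)
  have hG : Tendsto (fun z : ℍ => nomePhi (qp (1 / 104) z) (t z)) atImInfty (𝓝 1) := by
    have h := (continuous_nomePhi.tendsto (0, 1)).comp
      ((tendsto_qp_atImInfty (α := 1 / 104) (by norm_num)).prodMk_nhds htlim)
    rwa [nomePhi_zero_one] at h
  have h := hG.div (hPlim.pow 12) (by norm_num)
  rw [one_pow, div_one] at h
  refine h.congr fun z => ?_
  have heta : etaF z = qp (1 / 24) z * P z := rfl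
  have h52 : qp (1 / 104) z ^ 52 = qp (1 / 24) z ^ 12 := by
    rw [← qp_natCast_div, ← qp_natCast_div]
    norm_num
  have hne : qp (1 / 24) z ≠ 0 := Complex.exp_ne_zero _
  rw [Phi12'_X, Avec_eq_nomeVec, Phi12'_nomeVec, Delta, h52, heta]
  by_cases hz : P z = 0
  · simp [hz]
  · simp only [Pi.div_apply, ht]
    field_simp

theorem etaF_add_one_pow_twelve (z : ℂ) : etaF (z + 1) ^ 12 = -etaF z ^ 12 := by
  have h : qp (1 / 24) (z + 1) ^ 12 = -qp (1 / 24) z ^ 12 := by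
    rw [qp, qp, ← Complex.exp_nat_mul, ← Complex.exp_nat_mul, neg_eq_neg_one_mul,
      ← Complex.exp_pi_mul_I, ← Complex.exp_add]
    push_cast
    congr 1
    ring
  have hq : Complex.exp (2 * Real.pi * I * (z + 1)) = Complex.exp (2 * Real.pi * I * z) := by
    rw [mul_add, mul_one, Complex.exp_add, Complex.exp_two_pi_mul_I, mul_one]
  rw [etaF, etaF, mul_pow, mul_pow, h, hq, neg_mul]

theorem sqrt_pow_twelve (z : ℂ) : sqrt z ^ 12 = z ^ 6 := by
  rw [Complex.sqrt, ← Complex.cpow_nat_mul, ← Complex.cpow_natCast]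
  norm_num

theorem etaF_S_pow_twelve {z : ℂ} (hz : 0 < z.im) : etaF (-1 / z) ^ 12 = -z ^ 6 * etaF z ^ 12 := by
  have h : ModularForm.eta (-1 / z) = (sqrt I)⁻¹ * (sqrt z * ModularForm.eta z) :=
    ModularForm.eta_comp_eq_csqrt_I_inv hz
  rw [etaF_eq, etaF_eq, h, mul_pow, mul_pow, inv_pow, sqrt_pow_twelve,
    sqrt_pow_twelve, show I ^ 6 = -1 by rw [show 6 = 2 * 3 by norm_num, pow_mul, I_sq]; norm_num]
  norm_num [mul_assoc]

theorem Phi12'_X_eq (z : ℂ) : Phi12' (X z) = etaF z ^ 12 * Phi12' (oddVec (thetaFn z)) := by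
  rw [Phi12'_X, Avec_eq]

theorem Phi12'_X_add_one (z : ℂ) : Phi12' (X (z + 1)) = Phi12' (X z) := by
  rw [Phi12'_X_eq, Phi12'_X_eq, Phi12'_thetaFn_add_one, etaF_add_one_pow_twelve, neg_mul_neg]

theorem Phi12'_X_S {z : ℂ} (hz : 0 < z.im) :
    Phi12' (X (-1 / z)) = z ^ 12 * Phi12' (X z) := by
  rw [Phi12'_X_eq, Phi12'_X_eq, Phi12'_thetaFn_S hz, etaF_S_pow_twelve hz]
  ring

theorem Phi12'_X_slash_T :
    (fun z : ℍ => Phi12' (X z)) ∣[(12 : ℤ)] ModularGroup.T = fun z : ℍ => Phi12' (X z) := by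
  ext z
  have hT : ((ModularGroup.T • z : ℍ) : ℂ) = z + 1 := by
    rw [modular_T_smul, UpperHalfPlane.coe_vadd, add_comm]
    simp
  rw [ModularForm.SL_slash_apply, hT, Phi12'_X_add_one, ModularGroup.denom_apply]
  simp [ModularGroup.T]

theorem Phi12'_X_slash_S :
    (fun z : ℍ => Phi12' (X z)) ∣[(12 : ℤ)] ModularGroup.S = fun z : ℍ => Phi12' (X z) := by
  ext z
  have hS : ((ModularGroup.S • z : ℍ) : ℂ) = -1 / z := by
    rw [modular_S_smul, neg_div, one_div]
    simp
  rw [ModularForm.SL_slash_apply, hS, Phi12'_X_S z.im_pos, ModularGroup.denom_S]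
  have := z.ne_zero
  field_simp

theorem differentiableAt_thetaFn {z : ℂ} (hz : 0 < z.im) (x : ZMod 13) :
    DifferentiableAt ℂ (fun z => thetaFn z x) z := by
  obtain ⟨m, rfl⟩ := ZMod.intCast_surjective x
  have h13 : 0 < (13 * z).im := by simpa using hz
  have h := (hasFDerivAt_jacobiTheta₂ (1 / 2 + (2 * m + 13) * z / 2) h13).differentiableAt
  have h2 := h.comp (f := fun z : ℂ => ((1 / 2 + (2 * m + 13) * z / 2, 13 * z) : ℂ × ℂ)) z
    (by fun_prop)
  simp only [thetaFn_intCast]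
  exact (by fun_prop : DifferentiableAt ℂ (fun z : ℂ =>
    (-1 : ℂ) ^ m * Complex.exp (Real.pi * I * (2 * m + 13) ^ 2 / 52 * z)) z).mul h2

theorem differentiableAt_Phi12'_X {z : ℂ} (hz : 0 < z.im) :
    DifferentiableAt ℂ (fun z => Phi12' (X z)) z := by
  have heta : DifferentiableAt ℂ etaF z := by
    rw [funext etaF_eq]
    exact ModularForm.differentiableAt_eta_of_mem_upperHalfPlaneSet hz
  have hphi : Differentiable ℂ Phi12' := by
    unfold Phi12' w winf A
    fun_prop
  have hX : DifferentiableAt ℂ (fun z => oddVec (thetaFn z)) z := by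
    rw [differentiableAt_pi]
    intro i
    fin_cases i <;> exact differentiableAt_thetaFn hz _
  simp only [Phi12'_X_eq]
  exact (heta.pow 12).mul (hphi.differentiableAt.comp z hX)

theorem Delta_eq_discriminant (z : ℍ) : Delta z = ModularForm.discriminant z := by
  rw [Delta, etaF_eq, ModularForm.discriminant]

theorem isZeroAtImInfty_Phi12'_X : IsZeroAtImInfty fun z : ℍ => Phi12' (X z) := by
  have h := tendsto_Phi12'_X_div_Delta.mul ModularForm.discriminant_isZeroAtImInfty
  rw [mul_zero] at h
  refine Tendsto.congr (fun z => ?_) h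
  rw [Delta_eq_discriminant, div_mul_cancel₀ _ (ModularForm.discriminant_ne_zero z)]

/-- `Phi12'` at the theta constants of order `13`, as a cusp form of weight `12`. -/
def cuspFormPhi12' : CuspForm 𝒮ℒ 12 where
  toFun z := Phi12' (X z)
  slash_action_eq' γ hγ := by
    obtain ⟨γ, rfl⟩ := hγ
    exact SlashInvariantForm.slash_action_generators_SL2Z Phi12'_X_slash_S Phi12'_X_slash_T γ
  holo' := by
    rw [UpperHalfPlane.mdifferentiable_iff]
    refine .congr (fun z hz => (differentiableAt_Phi12'_X hz).differentiableWithinAt)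
      fun z hz => ?_
    simp [ofComplex_apply_of_im_pos hz]
  zero_at_cusps' hc := by
    rw [Subgroup.IsArithmetic.isCusp_iff_isCusp_SL2Z] at hc
    rw [OnePoint.isZeroAt_iff_forall_SL2Z hc]
    intro γ _
    rw [SlashInvariantForm.slash_action_generators_SL2Z Phi12'_X_slash_S Phi12'_X_slash_T]
    exact isZeroAtImInfty_Phi12'_X

/-- `Φ12′(x1(z),…,x6(z)) = Δ(z)` on ℍ. -/
theorem stmt_14 (z : ℂ) (hz : 0 < z.im) : Phi12' (X z) = Delta z := by
  obtain ⟨c, hc⟩ := CuspForm.exists_smul_discriminant_of_weight_eq_twelve cuspFormPhi12'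
  have hval (τ : ℍ) : Phi12' (X τ) = c * Delta τ := by
    rw [Delta_eq_discriminant]
    exact (DFunLike.congr_fun hc τ).symm
  have hone : c = 1 := by
    refine tendsto_nhds_unique (tendsto_const_nhds.congr fun τ => ?_) tendsto_Phi12'_X_div_Delta
    rw [hval, Delta_eq_discriminant, mul_div_cancel_right₀ _ (ModularForm.discriminant_ne_zero τ)]
  simpa [hone] using hval ⟨z, hz⟩

end
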